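/- Let H'_{n,r} be the associative unital R-algebra with generators t'_1,…,t'_n, g'_1,…,g'_{n−1} and defining relations: (1) (t'_i − u_1)⋯(t'_i − u_r) = 0; (2) t'_i t'_j = t'_j t'_i; (3) g'_j t'_i = t'_{s_j(i)} g'_j; (4) g'_i g'_j = g'_j g'_i for |i − j| > 1; (5) g'_i g'_{i+1} g'_i = g'_{i+1} g'_i g'_{i+1}; (6) (g'_i)² = 1 + (q − q^{−1})·e'_i·g'_i, where e'_i := Σ_{(k_1,…,k_n) with k_i = k_{i+1}} b'_{k_1,…,k_n} and b'_{k_1,…,k_n} := ∏_{i=1}^n ∏_{1≤j≤r, j≠k_i} (t'_i − u_j)·(u_{k_i} − u_j)^{−1}. Then the R-algebra homomorphism H'_{n,r} → H_{n,r} sending t'_i ↦ t_i and g'_i ↦ g_i := T_i + B'_{i,i+1} is an isomorphism; in other words, the generators t_1,…,t_n, g_1,…,g_{n−1} and relations (1)–(6) give a presentation of H_{n,r}. -/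

import Mathlib

open Polynomial

namespace MAK

noncomputable section

variable (R : Type*) [CommRing R] (n r : ℕ) (q Δ : Rˣ) (u : Fin r → R) (F : Fin r → R[X])

/-- The free `R`-algebra on generators `t_1, …, t_n` (left) and `T_1, …, T_{n-1}` (right). -/
abbrev FA := FreeAlgebra R (Fin n ⊕ Fin (n - 1))

/-- The generators `t_i`. -/
def tf (i : Fin n) : FA R n := FreeAlgebra.ι R (Sum.inl i)

/-- The generators `T_j`. -/
def Tf (j : Fin (n - 1)) : FA R n := FreeAlgebra.ι R (Sum.inr j)

/-- The index `j`, viewed in `Fin n`. -/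
def lo (j : Fin (n - 1)) : Fin n := ⟨j.1, by have := j.2; omega⟩

/-- The index `j + 1`, viewed in `Fin n`. -/
def hi (j : Fin (n - 1)) : Fin n := ⟨j.1 + 1, by have := j.2; omega⟩

/-- The element `B_j = Δ⁻² Σ_{c1<c2} (u_{c2} - u_{c1})(q - q⁻¹) F_{c1}(t_j) F_{c2}(t_{j+1})`. -/
def Bel (j : Fin (n - 1)) : FA R n :=
  ∑ c2 : Fin r, ∑ c1 ∈ Finset.univ.filter (fun c1 => c1 < c2),
    (((Δ⁻¹ : Rˣ) : R) ^ 2 * ((u c2 - u c1) * ((q : R) - ((q⁻¹ : Rˣ) : R)))) •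
      (aeval (tf R n (lo n j)) (F c1) * aeval (tf R n (hi n j)) (F c2))

/-- The defining relations of the modified Ariki-Koike algebra. -/
inductive Rel : FA R n → FA R n → Prop
  | quad (j : Fin (n - 1)) :
      Rel ((Tf R n j - algebraMap R (FA R n) (q : R)) *
        (Tf R n j + algebraMap R (FA R n) ((q⁻¹ : Rˣ) : R))) 0
  | tord (i : Fin n) : Rel (aeval (tf R n i) (∏ c : Fin r, (X - C (u c)))) 0
  | braid (j k : Fin (n - 1)) (h : k.1 = j.1 + 1) :
      Rel (Tf R n j * Tf R n k * Tf R n j) (Tf R n k * Tf R n j * Tf R n k)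
  | Tcomm (j k : Fin (n - 1)) (h : j.1 + 2 ≤ k.1 ∨ k.1 + 2 ≤ j.1) :
      Rel (Tf R n j * Tf R n k) (Tf R n k * Tf R n j)
  | tcomm (i i' : Fin n) : Rel (tf R n i * tf R n i') (tf R n i' * tf R n i)
  | Tt (j : Fin (n - 1)) (i : Fin n) (h1 : i ≠ lo n j) (h2 : i ≠ hi n j) :
      Rel (Tf R n j * tf R n i) (tf R n i * Tf R n j)
  | Thi (j : Fin (n - 1)) :
      Rel (Tf R n j * tf R n (hi n j)) (tf R n (lo n j) * Tf R n j + Bel R n r q Δ u F j)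
  | Tlo (j : Fin (n - 1)) :
      Rel (Tf R n j * tf R n (lo n j)) (tf R n (hi n j) * Tf R n j - Bel R n r q Δ u F j)

/-- The modified Ariki-Koike algebra `H_{n,r}(R, q, u_1, …, u_r)`. -/
abbrev Hnr := RingQuot (Rel R n r q Δ u F)

/-- The canonical projection. -/
def pim : FA R n →ₐ[R] Hnr R n r q Δ u F := RingQuot.mkAlgHom R (Rel R n r q Δ u F)

/-- The generator `t_i` of `H_{n,r}`. -/
def tt (i : Fin n) : Hnr R n r q Δ u F := pim R n r q Δ u F (tf R n i)

/-- The generator `T_j` of `H_{n,r}`. -/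
def TT (j : Fin (n - 1)) : Hnr R n r q Δ u F := pim R n r q Δ u F (Tf R n j)

/-- The Lagrange basis polynomial `∏_{j ≠ c} (X - u_j)/(u_c - u_j)`. -/
def bpoly (c : Fin r) : R[X] :=
  ∏ j ∈ Finset.univ.filter (fun j => j ≠ c), Ring.inverse (u c - u j) • (X - C (u j))

/-- The idempotent `b_{k_1, …, k_n}`. -/
def b (k : Fin n → Fin r) : Hnr R n r q Δ u F :=
  (List.ofFn fun i : Fin n => aeval (tt R n r q Δ u F i) (bpoly R r u (k i))).prod

/-- The element `B'_{i,j} = -(q - q⁻¹) Σ_{k_i < k_j} b_{k_1, …, k_n}`. -/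
def B' (i j : Fin n) : Hnr R n r q Δ u F :=
  -(((q : R) - ((q⁻¹ : Rˣ) : R)) •
    ∑ k ∈ Finset.univ.filter (fun k : Fin n → Fin r => k i < k j), b R n r q Δ u F k)

/-- The element `g_i := T_i + B'_{i,i+1}`. -/
def g (j : Fin (n - 1)) : Hnr R n r q Δ u F :=
  TT R n r q Δ u F j + B' R n r q Δ u F (lo n j) (hi n j)

/-- The idempotent `e_{i,j} = Σ_{k_i = k_j} b_{k_1, …, k_n}`. -/
def eij (i j : Fin n) : Hnr R n r q Δ u F :=
  ∑ k ∈ Finset.univ.filter (fun k : Fin n → Fin r => k i = k j), b R n r q Δ u F k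

/-- The idempotent `e_i = e_{i,i+1}`. -/
def ee (j : Fin (n - 1)) : Hnr R n r q Δ u F := eij R n r q Δ u F (lo n j) (hi n j)

/-- The simple transposition `s_j = (j, j+1)` in `S_n`. -/
def simple (j : Fin (n - 1)) : Equiv.Perm (Fin n) := Equiv.swap (lo n j) (hi n j)

/-- `l` is a reduced word for the permutation `w`. -/
def IsReducedWord (w : Equiv.Perm (Fin n)) (l : List (Fin (n - 1))) : Prop :=
  (l.map (simple n)).prod = w ∧
    ∀ l' : List (Fin (n - 1)), (l'.map (simple n)).prod = w → l.length ≤ l'.length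

/-- The element `g_w = g_{i_1} ⋯ g_{i_l}` associated to a word `l = (i_1, …, i_l)`. -/
def gword (l : List (Fin (n - 1))) : Hnr R n r q Δ u F := (l.map (g R n r q Δ u F)).prod

/-- The element `T_w = T_{i_1} ⋯ T_{i_l}` associated to a word `l = (i_1, …, i_l)`. -/
def Tword (l : List (Fin (n - 1))) : Hnr R n r q Δ u F := (l.map (TT R n r q Δ u F)).prod

/-- The monomial `t_1^{c_1} ⋯ t_n^{c_n}`. -/
def tmon (c : Fin n → ℕ) : Hnr R n r q Δ u F :=
  (List.ofFn fun i : Fin n => tt R n r q Δ u F i ^ c i).prod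

end

end MAK

open MAK


namespace MAK

noncomputable section

variable (R : Type*) [CommRing R] (n r : ℕ) (q : Rˣ) (u : Fin r → R)

/-- The element `b_{k_1,…,k_n}` inside the free algebra. -/
def bfree (k : Fin n → Fin r) : FA R n :=
  (List.ofFn fun i : Fin n => aeval (tf R n i) (bpoly R r u (k i))).prod

/-- The element `e_i` inside the free algebra. -/
def efree (j : Fin (n - 1)) : FA R n :=
  ∑ k ∈ Finset.univ.filter (fun k : Fin n → Fin r => k (lo n j) = k (hi n j)),
    bfree R n r u k

/-- The Yokonuma-Hecke-like relations (1)-(6) of Theorem 3.12, on generators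
`t'_1,…,t'_n` and `g'_1,…,g'_{n-1}`. -/
inductive Rel' : FA R n → FA R n → Prop
  | tord (i : Fin n) : Rel' (aeval (tf R n i) (∏ c : Fin r, (X - C (u c)))) 0
  | tcomm (i i' : Fin n) : Rel' (tf R n i * tf R n i') (tf R n i' * tf R n i)
  | gt (j : Fin (n - 1)) (i : Fin n) :
      Rel' (Tf R n j * tf R n i) (tf R n (Equiv.swap (lo n j) (hi n j) i) * Tf R n j)
  | gcomm (j k : Fin (n - 1)) (h : j.1 + 2 ≤ k.1 ∨ k.1 + 2 ≤ j.1) :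
      Rel' (Tf R n j * Tf R n k) (Tf R n k * Tf R n j)
  | gbraid (j k : Fin (n - 1)) (h : k.1 = j.1 + 1) :
      Rel' (Tf R n j * Tf R n k * Tf R n j) (Tf R n k * Tf R n j * Tf R n k)
  | gquad (j : Fin (n - 1)) :
      Rel' (Tf R n j * Tf R n j)
        (1 + ((q : R) - ((q⁻¹ : Rˣ) : R)) • (efree R n r u j * Tf R n j))

/-- The algebra `H'_{n,r}` defined by the Yokonuma-Hecke-like presentation. -/
abbrev Hnr' := RingQuot (Rel' R n r q u)

/-- The generator `t'_i` of `H'_{n,r}`. -/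
def tt' (i : Fin n) : Hnr' R n r q u := RingQuot.mkAlgHom R (Rel' R n r q u) (tf R n i)

/-- The generator `g'_j` of `H'_{n,r}`. -/
def gg' (j : Fin (n - 1)) : Hnr' R n r q u :=
  RingQuot.mkAlgHom R (Rel' R n r q u) (Tf R n j)

end

end MAK

namespace MAK

section CoordinateRing

variable {R : Type*} [CommRing R] {n r : ℕ} {u : Fin r → R}

/-- The coordinate function `k ↦ u (k i)` on the set of multi-indices. -/
def coord (n : ℕ) (u : Fin r → R) (i : Fin n) : (Fin n → Fin r) → R := fun k => u (k i)

theorem eval_bpoly (hu : ∀ i j, i ≠ j → IsUnit (u i - u j)) (c d : Fin r) :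
    (bpoly R r u c).eval (u d) = if d = c then 1 else 0 := by
  rw [bpoly, eval_prod]
  split_ifs with h
  · subst h
    refine Finset.prod_eq_one fun j hj => ?_
    simp only [Finset.mem_filter, Finset.mem_univ, true_and] at hj
    simp [Ring.inverse_mul_cancel _ (hu d j hj.symm)]
  · exact Finset.prod_eq_zero (i := d) (by simpa using h) (by simp)

/-- Polynomials which agree at all `u c` agree at every root of `∏ (X - u c)`. -/
theorem aeval_eq_aeval_of_eval_eq {A : Type*} [Ring A] [Algebra R A]
    (hu : ∀ i j, i ≠ j → IsUnit (u i - u j)) {x : A}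
    (hx : aeval x (∏ c : Fin r, (X - C (u c))) = 0) {f f' : R[X]}
    (h : ∀ c, f.eval (u c) = f'.eval (u c)) : aeval x f = aeval x f' := by
  have hdvd : (∏ c : Fin r, (X - C (u c))) ∣ f - f' := by
    refine Finset.prod_dvd_of_coprime ?_ ?_
    · intro i _ j _ hij
      exact isCoprime_X_sub_C_of_isUnit_sub (hu i j hij)
    · intro i _
      rw [dvd_iff_isRoot, IsRoot, eval_sub, h, sub_self]
  obtain ⟨p, hp⟩ := hdvd
  rw [← sub_eq_zero, ← map_sub, hp, map_mul, hx, zero_mul]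

theorem aeval_coord (i : Fin n) (f : R[X]) :
    aeval (coord n u i) f = fun k => f.eval (u (k i)) := by
  funext k
  have := aeval_algHom_apply (Pi.evalAlgHom R (fun _ : Fin n → Fin r => R) k) (coord n u i) f
  exact this.symm

theorem prod_aeval_coord (hu : ∀ i j, i ≠ j → IsUnit (u i - u j)) (k : Fin n → Fin r) :
    ∏ i, aeval (coord n u i) (bpoly R r u (k i)) = Pi.single k 1 := by
  funext l
  simp only [aeval_coord, eval_bpoly hu, Finset.prod_apply, Pi.single_apply]
  rw [Finset.prod_ite_zero]
  simp [funext_iff]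

theorem adjoin_coord (hu : ∀ i j, i ≠ j → IsUnit (u i - u j)) :
    Algebra.adjoin R (Set.range (coord n u)) = ⊤ := by
  rw [eq_top_iff]
  intro f _
  have hf : f = ∑ k, f k • (Pi.single k 1 : (Fin n → Fin r) → R) := by
    funext l
    simp [Finset.sum_apply, Pi.single_apply]
  rw [hf]
  refine Subalgebra.sum_mem _ fun k _ => Subalgebra.smul_mem _ ?_ _
  rw [← prod_aeval_coord hu]
  refine Subalgebra.prod_mem _ fun i _ => ?_
  exact Algebra.adjoin_mono (by simp) (aeval_mem_adjoin_singleton R (coord n u i))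

theorem exists_algHom_of_comm {A : Type*} [CommRing A] [Algebra R A]
    (hu : ∀ i j, i ≠ j → IsUnit (u i - u j)) (t : Fin n → A)
    (ht : ∀ i, aeval (t i) (∏ c : Fin r, (X - C (u c))) = 0) :
    ∃ ρ : ((Fin n → Fin r) → R) →ₐ[R] A, ∀ i, ρ (coord n u i) = t i := by
  classical
  set p : Fin n → Fin r → A := fun i c => aeval (t i) (bpoly R r u c) with hp
  have hmul : ∀ i c d, p i c * p i d = if c = d then p i c else 0 := by
    intro i c d
    have h : aeval (t i) (bpoly R r u c * bpoly R r u d) =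
        aeval (t i) (if c = d then bpoly R r u c else 0) := by
      refine aeval_eq_aeval_of_eval_eq hu (ht i) fun e => ?_
      rw [eval_mul, eval_bpoly hu, eval_bpoly hu]
      split_ifs <;> simp_all [eval_bpoly hu]
    rw [map_mul] at h
    rw [hp]
    dsimp only
    rw [h]
    split_ifs <;> simp
  have hsum : ∀ i, ∑ c, p i c = 1 := by
    intro i
    have h : aeval (t i) (∑ c, bpoly R r u c) = aeval (t i) (1 : R[X]) := by
      refine aeval_eq_aeval_of_eval_eq hu (ht i) fun e => ?_
      simp [eval_finsetSum, eval_bpoly hu]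
    simpa using h
  have htp : ∀ i c, u c • p i c = t i * p i c := by
    intro i c
    have h : aeval (t i) (u c • bpoly R r u c) = aeval (t i) (X * bpoly R r u c) := by
      refine aeval_eq_aeval_of_eval_eq hu (ht i) fun e => ?_
      simp only [eval_smul, eval_mul, eval_X, eval_bpoly hu]
      split_ifs with h <;> simp [h]
    simpa using h
  set e : (Fin n → Fin r) → A := fun k => ∏ i, p i (k i) with he
  have hemul : ∀ k l, e k * e l = if k = l then e k else 0 := by
    intro k l
    rw [he]
    dsimp only
    rw [← Finset.prod_mul_distrib]
    simp only [hmul]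
    rw [Finset.prod_ite_zero]
    simp [funext_iff]
  have hesum : ∑ k, e k = 1 := by
    rw [he, ← Fintype.piFinset_univ, ← Finset.prod_univ_sum]
    simp [hsum]
  have hte : ∀ i k, u (k i) • e k = t i * e k := by
    intro i k
    rw [he]
    dsimp only
    rw [← Finset.mul_prod_erase _ _ (Finset.mem_univ i), ← smul_mul_assoc, htp, mul_assoc]
  let L : ((Fin n → Fin r) → R) →ₗ[R] A := Fintype.linearCombination R e
  have hL : ∀ f, L f = ∑ k, f k • e k := fun f => Fintype.linearCombination_apply R e f
  refine ⟨AlgHom.ofLinearMap L ?_ ?_, fun i => ?_⟩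
  · simp [hL, hesum]
  · intro f f'
    simp [hL, Finset.sum_mul_sum, hemul, mul_smul, smul_comm (f' _)]
  · change L _ = _
    rw [hL]
    simp only [coord, hte, ← Finset.mul_sum, hesum, mul_one]

open scoped IsMulCommutative in
theorem exists_algHom {A : Type*} [Ring A] [Algebra R A]
    (hu : ∀ i j, i ≠ j → IsUnit (u i - u j)) (t : Fin n → A)
    (hcomm : ∀ i j, t i * t j = t j * t i)
    (ht : ∀ i, aeval (t i) (∏ c : Fin r, (X - C (u c))) = 0) :
    ∃ ρ : ((Fin n → Fin r) → R) →ₐ[R] A, ∀ i, ρ (coord n u i) = t i := by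
  let S := Algebra.adjoin R (Set.range t)
  have : IsMulCommutative S := Algebra.isMulCommutative_adjoin R (by
    rintro _ ⟨i, rfl⟩ _ ⟨j, rfl⟩
    exact hcomm i j)
  let t' : Fin n → S := fun i => ⟨t i, Algebra.subset_adjoin ⟨i, rfl⟩⟩
  obtain ⟨ρ, hρ⟩ := exists_algHom_of_comm (A := S) hu t' (by
    intro i
    apply Subtype.val_injective
    have := aeval_algHom_apply S.val (t' i) (∏ c : Fin r, (X - C (u c)))
    exact this.symm.trans (ht i))
  exact ⟨S.val.comp ρ, fun i => congrArg S.val (hρ i)⟩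

theorem algHom_ext {A : Type*} [Ring A] [Algebra R A]
    (hu : ∀ i j, i ≠ j → IsUnit (u i - u j)) {ρ ρ' : ((Fin n → Fin r) → R) →ₐ[R] A}
    (h : ∀ i, ρ (coord n u i) = ρ' (coord n u i)) : ρ = ρ' := by
  refine AlgHom.ext_of_adjoin_eq_top (adjoin_coord hu) ?_
  rintro _ ⟨i, rfl⟩
  exact h i

/-- An element intertwining the coordinates through `σ` intertwines all functions. -/
theorem intertwine {A : Type*} [Ring A] [Algebra R A]
    (hu : ∀ i j, i ≠ j → IsUnit (u i - u j)) {ρ : ((Fin n → Fin r) → R) →ₐ[R] A} {x : A}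
    {σ : Fin n → Fin n} (h : ∀ i, x * ρ (coord n u i) = ρ (coord n u (σ i)) * x)
    (f : (Fin n → Fin r) → R) : x * ρ f = ρ (fun k => f (fun i => k (σ i))) * x := by
  have hf : f ∈ Algebra.adjoin R (Set.range (coord n u)) := adjoin_coord hu ▸ Algebra.mem_top
  induction hf using Algebra.adjoin_induction with
  | mem f hf =>
    obtain ⟨i, rfl⟩ := hf
    exact h i
  | algebraMap a =>
    have h' : (fun k : Fin n → Fin r => algebraMap R ((Fin n → Fin r) → R) a
        (fun i => k (σ i))) = algebraMap R _ a := rfl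
    rw [h', AlgHom.commutes, Algebra.commutes]
  | add f f' _ _ hf hf' =>
    have h' : (fun k : Fin n → Fin r => (f + f') (fun i => k (σ i))) =
      (fun k => f (fun i => k (σ i))) + fun k => f' (fun i => k (σ i)) := rfl
    rw [h', map_add, map_add, mul_add, add_mul, hf, hf']
  | mul f f' _ _ hf hf' =>
    have h' : (fun k : Fin n → Fin r => (f * f') (fun i => k (σ i))) =
      (fun k => f (fun i => k (σ i))) * fun k => f' (fun i => k (σ i)) := rfl
    rw [h', map_mul, map_mul, ← mul_assoc, hf, mul_assoc, hf', mul_assoc]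

end CoordinateRing

theorem braid_sub_braid {A : Type*} [Ring A] {x y a a' d d' m e e' : A}
    (hxa : x * a = a' * x) (hxd : x * d = m * x) (hxm : x * m = d * x)
    (hya : y * a = m * y) (hyd : y * d = d' * y) (hym : y * m = a * y)
    (hx : x * x = 1 + e * x) (hy : y * y = 1 + e' * y)
    (h₁ : a * d + m * e + m * a' = d * m) (h₂ : a * m = d * a + m * d' + m * e')
    (h₃ : a * d * a = d * a * d) :
    (x + a) * (y + d) * (x + a) - (y + d) * (x + a) * (y + d) = x * y * x - y * x * y := by
  have e₁ : x * y * a = d * x * y := by rw [mul_assoc, hya, ← mul_assoc, hxm]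
  have e₂ : x * d * x = m + m * e * x := by rw [hxd, mul_assoc, hx]; noncomm_ring
  have e₃ : x * d * a = m * a' * x := by rw [hxd, mul_assoc, hxa, mul_assoc]
  have e₄ : a * y * a = a * m * y := by rw [mul_assoc, hya, mul_assoc]
  have e₅ : y * x * d = a * y * x := by rw [mul_assoc, hxd, ← mul_assoc, hym]
  have e₆ : y * a * y = m + m * e' * y := by rw [hya, mul_assoc, hy]; noncomm_ring
  have e₇ : y * a * d = m * d' * y := by rw [hya, mul_assoc, hyd, mul_assoc]
  have e₈ : d * x * d = d * m * x := by rw [mul_assoc, hxd, mul_assoc]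
  simp only [mul_add, add_mul, e₁, e₂, e₃, e₄, e₅, e₆, e₇, e₈, h₃, h₂, ← h₁]
  abel

section Transfer

variable {R : Type*} [CommRing R] {n r : ℕ} {q Δ : Rˣ} {u : Fin r → R} {F : Fin r → R[X]}

/-- The function `k ↦ c` if `k i < k j`, and `0` otherwise. -/
def ltFun (r : ℕ) (c : R) (i j : Fin n) : (Fin n → Fin r) → R :=
  fun k => if k i < k j then c else 0

/-- The function `k ↦ c` if `k i = k j`, and `0` otherwise. -/
def eqFun (r : ℕ) (c : R) (i j : Fin n) : (Fin n → Fin r) → R :=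
  fun k => if k i = k j then c else 0

variable {A : Type*} [Ring A] [Algebra R A] {ρ : ((Fin n → Fin r) → R) →ₐ[R] A}

theorem map_aeval_tf {f : FA R n →ₐ[R] A} (hf : ∀ i, f (tf R n i) = ρ (coord n u i))
    (i : Fin n) (p : R[X]) : f (aeval (tf R n i) p) = ρ (fun k => p.eval (u (k i))) := by
  rw [← aeval_algHom_apply, hf, aeval_algHom_apply, aeval_coord]

theorem map_bfree (hu : ∀ i j, i ≠ j → IsUnit (u i - u j)) {f : FA R n →ₐ[R] A}
    (hf : ∀ i, f (tf R n i) = ρ (coord n u i)) (k : Fin n → Fin r) :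
    f (bfree R n r u k) = ρ (Pi.single k 1) := by
  rw [← prod_aeval_coord hu, bfree, map_list_prod, ← List.prod_ofFn, map_list_prod,
    List.map_ofFn, List.map_ofFn]
  congr 2
  funext i
  simp only [Function.comp_apply]
  rw [map_aeval_tf hf, aeval_coord]

theorem map_sum_bfree (hu : ∀ i j, i ≠ j → IsUnit (u i - u j)) {f : FA R n →ₐ[R] A}
    (hf : ∀ i, f (tf R n i) = ρ (coord n u i)) (S : (Fin n → Fin r) → Prop) [DecidablePred S] :
    f (∑ k ∈ Finset.univ.filter S, bfree R n r u k) = ρ (fun k => if S k then 1 else 0) := by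
  simp only [map_sum, map_bfree hu hf]
  rw [← map_sum]
  congr 1
  funext l
  simp [Finset.sum_apply, Pi.single_apply]

theorem smul_map_efree (hu : ∀ i j, i ≠ j → IsUnit (u i - u j)) {f : FA R n →ₐ[R] A}
    (hf : ∀ i, f (tf R n i) = ρ (coord n u i)) (c : R) (j : Fin (n - 1)) :
    c • f (efree R n r u j) = ρ (eqFun r c (lo n j) (hi n j)) := by
  rw [efree, map_sum_bfree hu hf, ← map_smul]
  congr 1
  funext k
  simp [eqFun]

theorem map_Bel (hFeval : ∀ c c' : Fin r, (F c).eval (u c') = if c' = c then (Δ : R) else 0)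
    {f : FA R n →ₐ[R] A} (hf : ∀ i, f (tf R n i) = ρ (coord n u i)) (j : Fin (n - 1)) :
    f (Bel R n r q Δ u F j) = ρ (ltFun r ((q : R) - ((q⁻¹ : Rˣ) : R)) (lo n j) (hi n j) *
      (coord n u (hi n j) - coord n u (lo n j))) := by
  simp only [Bel, map_sum, map_smul, map_mul, map_aeval_tf hf]
  simp only [← map_mul, ← map_smul, ← map_sum]
  congr 1
  funext k
  simp only [Finset.sum_apply, Pi.smul_apply, Pi.mul_apply, hFeval, smul_eq_mul, ltFun, coord,
    Pi.sub_apply]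
  rw [Finset.sum_eq_single (k (hi n j))]
  · simp only [Finset.sum_filter, mul_ite, ite_mul, mul_zero, zero_mul, if_true]
    rw [Finset.sum_eq_single (k (lo n j))]
    · rw [if_pos rfl]
      split_ifs with h
      · have hΔ : ((Δ⁻¹ : Rˣ) : R) * (Δ : R) = 1 := Units.inv_mul Δ
        linear_combination (((Δ⁻¹ : Rˣ) : R) * (Δ : R) + 1) *
          ((u (k (hi n j)) - u (k (lo n j))) * ((q : R) - ((q⁻¹ : Rˣ) : R))) * hΔ
      · rfl
    · intro c _ hc
      simp [hc.symm]
    · simp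
  · intro c _ hc
    refine Finset.sum_eq_zero fun d _ => ?_
    simp [hc.symm]
  · simp

theorem lo_ne_hi (j : Fin (n - 1)) : lo n j ≠ hi n j := by
  simp [lo, hi]

/-- `x` intertwines the coordinate functions through the transposition of `i` and `j`. -/
def IsSwap (ρ : ((Fin n → Fin r) → R) →ₐ[R] A) (u : Fin r → R) (i j : Fin n) (x : A) : Prop :=
  ∀ l, x * ρ (coord n u l) = ρ (coord n u (Equiv.swap i j l)) * x

theorem IsSwap.mul_ltFun (hu : ∀ i j, i ≠ j → IsUnit (u i - u j)) {i j : Fin n} {x : A}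
    (hx : IsSwap ρ u i j x) (c : R) (l m : Fin n) :
    x * ρ (ltFun r c l m) = ρ (ltFun r c (Equiv.swap i j l) (Equiv.swap i j m)) * x :=
  intertwine hu hx _

theorem quad_add_ltFun (hu : ∀ i j, i ≠ j → IsUnit (u i - u j)) (q : Rˣ) {i j : Fin n} {x : A}
    (hx : IsSwap ρ u i j x) :
    (x + ρ (ltFun r ((q : R) - ((q⁻¹ : Rˣ) : R)) i j) - algebraMap R A (q : R)) *
        (x + ρ (ltFun r ((q : R) - ((q⁻¹ : Rˣ) : R)) i j) + algebraMap R A ((q⁻¹ : Rˣ) : R)) =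
      x * x - (1 + ρ (eqFun r ((q : R) - ((q⁻¹ : Rˣ) : R)) i j) * x) := by
  set c : R := (q : R) - ((q⁻¹ : Rˣ) : R) with hc
  have h₁ := hx.mul_ltFun hu c i j
  rw [Equiv.swap_apply_left, Equiv.swap_apply_right] at h₁
  have h₂ : ρ (ltFun r c i j) * ρ (ltFun r c i j) =
      algebraMap R A q * ρ (ltFun r c i j) -
        algebraMap R A ((q⁻¹ : Rˣ) : R) * ρ (ltFun r c i j) := by
    rw [← sub_mul, ← map_sub, ← hc, ← ρ.commutes, ← map_mul, ← map_mul]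
    congr 1
    funext k
    simp only [Pi.mul_apply, ltFun, Pi.algebraMap_apply, Algebra.algebraMap_self, RingHom.id_apply]
    split_ifs <;> simp
  have h₃ : ρ (eqFun r c i j) = algebraMap R A q - algebraMap R A ((q⁻¹ : Rˣ) : R) -
      ρ (ltFun r c i j) - ρ (ltFun r c j i) := by
    rw [← map_sub, ← hc, ← ρ.commutes, ← map_sub, ← map_sub]
    congr 1
    funext k
    simp only [Pi.sub_apply, ltFun, eqFun, Pi.algebraMap_apply, Algebra.algebraMap_self,
      RingHom.id_apply]
    grind
  have h₄ : algebraMap R A q * algebraMap R A ((q⁻¹ : Rˣ) : R) = 1 := by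
    rw [← map_mul, Units.mul_inv, map_one]
  have h₅ := fun y : A => (Algebra.commutes (q : R) y).symm
  have h₆ := fun y : A => (Algebra.commutes ((q⁻¹ : Rˣ) : R) y).symm
  simp only [mul_add, add_mul, sub_mul, h₁, h₂, h₃, h₄, h₆ x, h₆ (ρ _)]
  abel

theorem braid_add_ltFun (hu : ∀ i j, i ≠ j → IsUnit (u i - u j)) (c : R) {i j k : Fin n}
    (hij : i ≠ j) (hik : i ≠ k) (hjk : j ≠ k) {x y : A}
    (hx : IsSwap ρ u i j x) (hy : IsSwap ρ u j k y)
    (hxx : x * x = 1 + ρ (eqFun r c i j) * x) (hyy : y * y = 1 + ρ (eqFun r c j k) * y) :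
    (x + ρ (ltFun r c i j)) * (y + ρ (ltFun r c j k)) * (x + ρ (ltFun r c i j)) -
      (y + ρ (ltFun r c j k)) * (x + ρ (ltFun r c i j)) * (y + ρ (ltFun r c j k)) =
      x * y * x - y * x * y := by
  have sx := Equiv.swap_apply_of_ne_of_ne (a := i) (b := j) hik.symm hjk.symm
  have sy := Equiv.swap_apply_of_ne_of_ne (a := j) (b := k) hij hik
  refine braid_sub_braid (a' := ρ (ltFun r c j i)) (d' := ρ (ltFun r c k j))
    (m := ρ (ltFun r c i k)) (e := ρ (eqFun r c i j)) (e' := ρ (eqFun r c j k))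
    ?_ ?_ ?_ ?_ ?_ ?_ hxx hyy ?_ ?_ ?_
  · simpa using hx.mul_ltFun hu c i j
  · simpa [sx] using hx.mul_ltFun hu c j k
  · simpa [sx] using hx.mul_ltFun hu c i k
  · simpa [sy] using hy.mul_ltFun hu c i j
  · simpa using hy.mul_ltFun hu c j k
  · simpa [sy] using hy.mul_ltFun hu c i k
  all_goals
    simp only [← map_mul, ← map_add]
    congr 1
    funext l
    simp only [Pi.mul_apply, Pi.add_apply, ltFun, eqFun]
    grind

theorem commute_add_ltFun_iff (hu : ∀ i j, i ≠ j → IsUnit (u i - u j)) (c : R)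
    {i j k l : Fin n} (hik : i ≠ k) (hil : i ≠ l) (hjk : j ≠ k) (hjl : j ≠ l) {x y : A}
    (hx : IsSwap ρ u i j x) (hy : IsSwap ρ u k l y) :
    (x + ρ (ltFun r c i j)) * (y + ρ (ltFun r c k l)) =
      (y + ρ (ltFun r c k l)) * (x + ρ (ltFun r c i j)) ↔ x * y = y * x := by
  have h₁ : x * ρ (ltFun r c k l) = ρ (ltFun r c k l) * x := by
    simpa [Equiv.swap_apply_of_ne_of_ne hik.symm hjk.symm,
      Equiv.swap_apply_of_ne_of_ne hil.symm hjl.symm] using hx.mul_ltFun hu c k l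
  have h₂ : y * ρ (ltFun r c i j) = ρ (ltFun r c i j) * y := by
    simpa [Equiv.swap_apply_of_ne_of_ne hik hil,
      Equiv.swap_apply_of_ne_of_ne hjk hjl] using hy.mul_ltFun hu c i j
  have h₃ : ρ (ltFun r c i j) * ρ (ltFun r c k l) = ρ (ltFun r c k l) * ρ (ltFun r c i j) := by
    rw [← map_mul, mul_comm, map_mul]
  have h₄ : (x + ρ (ltFun r c i j)) * (y + ρ (ltFun r c k l)) -
      (y + ρ (ltFun r c k l)) * (x + ρ (ltFun r c i j)) = x * y - y * x := by
    simp only [mul_add, add_mul, h₁, h₂, h₃]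
    abel
  rw [← sub_eq_zero, h₄, sub_eq_zero]

theorem isSwap_iff (c : R) {i j : Fin n} {x : A} :
    IsSwap ρ u i j x ↔
      (∀ l, l ≠ i → l ≠ j →
        (x + ρ (ltFun r c i j)) * ρ (coord n u l) = ρ (coord n u l) * (x + ρ (ltFun r c i j))) ∧
      (x + ρ (ltFun r c i j)) * ρ (coord n u j) = ρ (coord n u i) * (x + ρ (ltFun r c i j)) +
        ρ (ltFun r c i j * (coord n u j - coord n u i)) ∧
      (x + ρ (ltFun r c i j)) * ρ (coord n u i) = ρ (coord n u j) * (x + ρ (ltFun r c i j)) -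
        ρ (ltFun r c i j * (coord n u j - coord n u i)) := by
  have comm := fun l => (Commute.all (coord n u l) (ltFun r c i j)).map ρ
  have key : ∀ l m, (x + ρ (ltFun r c i j)) * ρ (coord n u l) -
      (ρ (coord n u m) * (x + ρ (ltFun r c i j)) +
        ρ (ltFun r c i j * (coord n u l - coord n u m))) =
      x * ρ (coord n u l) - ρ (coord n u m) * x := by
    intro l m
    simp only [map_mul, map_sub, mul_sub, add_mul, mul_add, (comm m).eq]
    abel
  have key' : ∀ l m, (x + ρ (ltFun r c i j)) * ρ (coord n u l) =
      ρ (coord n u m) * (x + ρ (ltFun r c i j)) +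
        ρ (ltFun r c i j * (coord n u l - coord n u m)) ↔
      x * ρ (coord n u l) = ρ (coord n u m) * x := by
    intro l m
    rw [← sub_eq_zero, key, sub_eq_zero]
  have hneg : ltFun r c i j * (coord n u j - coord n u i) =
      -(ltFun r c i j * (coord n u i - coord n u j)) := by ring
  rw [key' j i, hneg, map_neg, sub_neg_eq_add, key' i j]
  have hself : ∀ l, (x + ρ (ltFun r c i j)) * ρ (coord n u l) =
      ρ (coord n u l) * (x + ρ (ltFun r c i j)) ↔ x * ρ (coord n u l) = ρ (coord n u l) * x := by
    intro l
    simpa using key' l l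
  simp only [hself]
  constructor
  · intro h
    refine ⟨fun l hi hj => ?_, ?_, ?_⟩
    · simpa [Equiv.swap_apply_of_ne_of_ne hi hj] using h l
    · simpa using h j
    · simpa using h i
  · rintro ⟨h, hj, hi⟩ l
    by_cases hli : l = i
    · subst hli
      simpa using hi
    by_cases hlj : l = j
    · subst hlj
      simpa using hj
    simpa [Equiv.swap_apply_of_ne_of_ne hli hlj] using h l hli hlj

theorem map_tord {f : FA R n →ₐ[R] A} (hf : ∀ i, f (tf R n i) = ρ (coord n u i)) (i : Fin n) :
    f (aeval (tf R n i) (∏ c : Fin r, (X - C (u c)))) = 0 := by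
  rw [map_aeval_tf hf, ← map_zero ρ]
  congr 1
  funext k
  rw [eval_prod]
  exact Finset.prod_eq_zero (Finset.mem_univ (k i)) (by simp)

theorem map_tcomm {f : FA R n →ₐ[R] A} (hf : ∀ i, f (tf R n i) = ρ (coord n u i))
    (i j : Fin n) : f (tf R n i * tf R n j) = f (tf R n j * tf R n i) := by
  rw [map_mul, map_mul, hf, hf, ← map_mul, mul_comm, map_mul]

theorem lo_hi_far {j k : Fin (n - 1)} (h : j.1 + 2 ≤ k.1 ∨ k.1 + 2 ≤ j.1) :
    lo n j ≠ lo n k ∧ lo n j ≠ hi n k ∧ hi n j ≠ lo n k ∧ hi n j ≠ hi n k := by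
  simp only [lo, hi, ne_eq, Fin.mk.injEq]
  omega

theorem lo_hi_near {j k : Fin (n - 1)} (h : k.1 = j.1 + 1) :
    lo n k = hi n j ∧ lo n j ≠ hi n k := by
  simp only [lo, hi, ne_eq, Fin.mk.injEq]
  omega

/-- Under the change of generators `T_j = g_j + (q - q⁻¹) Σ_{k_j < k_{j+1}} b_k`, the relations of
`Rel` follow from those of `Rel'`. -/
theorem rel_of_rel' (hu : ∀ i j, i ≠ j → IsUnit (u i - u j))
    (hFeval : ∀ c c' : Fin r, (F c).eval (u c') = if c' = c then (Δ : R) else 0)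
    {f f' : FA R n →ₐ[R] A} (hf : ∀ i, f (tf R n i) = ρ (coord n u i))
    (hf' : ∀ i, f' (tf R n i) = ρ (coord n u i))
    (hTf : ∀ j, f (Tf R n j) = f' (Tf R n j) +
      ρ (ltFun r ((q : R) - ((q⁻¹ : Rˣ) : R)) (lo n j) (hi n j)))
    (h : ∀ ⦃x y⦄, Rel' R n r q u x y → f' x = f' y) ⦃x y : FA R n⦄
    (hxy : Rel R n r q Δ u F x y) : f x = f y := by
  have hswap : ∀ j, IsSwap ρ u (lo n j) (hi n j) (f' (Tf R n j)) := fun j l => by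
    simpa [hf'] using h (.gt j l)
  have hsq : ∀ j, f' (Tf R n j) * f' (Tf R n j) =
      1 + ρ (eqFun r ((q : R) - ((q⁻¹ : Rˣ) : R)) (lo n j) (hi n j)) * f' (Tf R n j) := by
    intro j
    rw [← smul_map_efree hu hf']
    simpa only [map_mul, map_add, map_one, map_smul, smul_mul_assoc] using h (.gquad j)
  have hT := fun j => (isSwap_iff ((q : R) - ((q⁻¹ : Rˣ) : R))).1 (hswap j)
  induction hxy with
  | quad j =>
    rw [map_mul, map_sub, map_add, f.commutes, f.commutes, hTf, quad_add_ltFun hu q (hswap j),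
      hsq, sub_self, map_zero]
  | tord i => rw [map_tord hf, map_zero]
  | braid j k hjk =>
    obtain ⟨h₁, h₂⟩ := lo_hi_near hjk
    have hk := hswap k
    have hkk := hsq k
    rw [h₁] at hk hkk
    have := braid_add_ltFun hu _ (lo_ne_hi j) h₂ (h₁ ▸ lo_ne_hi k) (hswap j) hk (hsq j) hkk
    have hb := h (.gbraid j k hjk)
    simp only [map_mul] at hb
    rw [hb, sub_self, sub_eq_zero] at this
    simpa only [map_mul, hTf, h₁] using this
  | Tcomm j k hjk =>
    obtain ⟨h₁, h₂, h₃, h₄⟩ := lo_hi_far hjk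
    have hc := h (.gcomm j k hjk)
    rw [map_mul, map_mul] at hc
    rw [map_mul, map_mul, hTf, hTf,
      (commute_add_ltFun_iff hu _ h₁ h₂ h₃ h₄ (hswap j) (hswap k)).2 hc]
  | tcomm i j => exact map_tcomm hf i j
  | Tt j i h₁ h₂ => simpa only [map_mul, hTf, hf] using (hT j).1 i h₁ h₂
  | Thi j => simpa only [map_mul, map_add, map_Bel hFeval hf, hTf, hf] using (hT j).2.1
  | Tlo j =>
    rw [map_mul, map_sub, map_Bel hFeval hf, map_mul, hTf, hf, hf]
    exact (hT j).2.2

/-- Under the change of generators `T_j = g_j + (q - q⁻¹) Σ_{k_j < k_{j+1}} b_k`, the relations of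
`Rel'` follow from those of `Rel`. -/
theorem rel'_of_rel (hu : ∀ i j, i ≠ j → IsUnit (u i - u j))
    (hFeval : ∀ c c' : Fin r, (F c).eval (u c') = if c' = c then (Δ : R) else 0)
    {f f' : FA R n →ₐ[R] A} (hf : ∀ i, f (tf R n i) = ρ (coord n u i))
    (hf' : ∀ i, f' (tf R n i) = ρ (coord n u i))
    (hTf : ∀ j, f (Tf R n j) = f' (Tf R n j) +
      ρ (ltFun r ((q : R) - ((q⁻¹ : Rˣ) : R)) (lo n j) (hi n j)))
    (h : ∀ ⦃x y⦄, Rel R n r q Δ u F x y → f x = f y) ⦃x y : FA R n⦄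
    (hxy : Rel' R n r q u x y) : f' x = f' y := by
  have hswap : ∀ j, IsSwap ρ u (lo n j) (hi n j) (f' (Tf R n j)) := by
    intro j
    refine (isSwap_iff ((q : R) - ((q⁻¹ : Rˣ) : R))).2 ⟨fun l h₁ h₂ => ?_, ?_, ?_⟩
    · simpa only [map_mul, hTf, hf] using h (.Tt j l h₁ h₂)
    · rw [← map_Bel hFeval hf, ← hTf, ← hf, ← hf, ← map_mul, ← map_mul, ← map_add]
      exact h (.Thi j)
    · rw [← map_Bel hFeval hf, ← hTf, ← hf, ← hf, ← map_mul, ← map_mul, ← map_sub]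
      exact h (.Tlo j)
  have hsq : ∀ j, f' (Tf R n j) * f' (Tf R n j) =
      1 + ρ (eqFun r ((q : R) - ((q⁻¹ : Rˣ) : R)) (lo n j) (hi n j)) * f' (Tf R n j) := by
    intro j
    have hq := h (.quad j)
    rwa [map_mul, map_sub, map_add, f.commutes, f.commutes, hTf, quad_add_ltFun hu q (hswap j),
      map_zero, sub_eq_zero] at hq
  induction hxy with
  | tord i => rw [map_tord hf', map_zero]
  | tcomm i j => exact map_tcomm hf' i j
  | gt j i => simpa only [map_mul, hf'] using hswap j i
  | gcomm j k hjk =>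
    obtain ⟨h₁, h₂, h₃, h₄⟩ := lo_hi_far hjk
    have hc := h (.Tcomm j k hjk)
    rw [map_mul, map_mul, hTf, hTf,
      commute_add_ltFun_iff hu _ h₁ h₂ h₃ h₄ (hswap j) (hswap k)] at hc
    rw [map_mul, map_mul, hc]
  | gbraid j k hjk =>
    obtain ⟨h₁, h₂⟩ := lo_hi_near hjk
    have hk := hswap k
    have hkk := hsq k
    rw [h₁] at hk hkk
    have := braid_add_ltFun hu _ (lo_ne_hi j) h₂ (h₁ ▸ lo_ne_hi k) (hswap j) hk (hsq j) hkk
    have hb := h (.braid j k hjk)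
    simp only [map_mul, hTf, h₁] at hb
    rw [hb, sub_self, eq_comm, sub_eq_zero] at this
    simpa only [map_mul] using this
  | gquad j =>
    rw [map_mul, hsq, ← smul_map_efree hu hf']
    simp only [map_add, map_one, map_smul, map_mul, smul_mul_assoc]

end Transfer

theorem isUnit_sub_of_eq_prod {R : Type*} [CommRing R] {r : ℕ} {Δ : Rˣ} {u : Fin r → R}
    (hΔ : (Δ : R) = ∏ i : Fin r, ∏ j ∈ Finset.univ.filter (fun j => j < i), (u i - u j))
    (i j : Fin r) (hij : i ≠ j) : IsUnit (u i - u j) := by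
  have key : ∀ i j : Fin r, j < i → IsUnit (u i - u j) := by
    intro i j hji
    refine isUnit_of_dvd_unit ?_ Δ.isUnit
    rw [hΔ]
    exact (Finset.dvd_prod_of_mem (fun j => u i - u j) (by simpa using hji)).trans
      (Finset.dvd_prod_of_mem
        (fun i => ∏ j ∈ Finset.univ.filter (fun j => j < i), (u i - u j)) (Finset.mem_univ i))
  rcases lt_or_gt_of_ne hij with h | h
  · simpa using (key j i h).neg
  · exact key i j h

section Generators

variable {R : Type*} [CommRing R] {n r : ℕ} {q Δ : Rˣ} {u : Fin r → R} {F : Fin r → R[X]}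

theorem pim_bfree (k : Fin n → Fin r) :
    pim R n r q Δ u F (bfree R n r u k) = b R n r q Δ u F k := by
  rw [bfree, b, map_list_prod, List.map_ofFn]
  congr 2
  funext i
  exact (aeval_algHom_apply _ _ _).symm

theorem B'_eq (hu : ∀ i j, i ≠ j → IsUnit (u i - u j))
    {ρ : ((Fin n → Fin r) → R) →ₐ[R] Hnr R n r q Δ u F}
    (hρ : ∀ i, ρ (coord n u i) = tt R n r q Δ u F i) (i j : Fin n) :
    B' R n r q Δ u F i j = -ρ (ltFun r ((q : R) - ((q⁻¹ : Rˣ) : R)) i j) := by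
  have h := map_sum_bfree (f := pim R n r q Δ u F) hu (fun l => (hρ l).symm)
    (fun k : Fin n → Fin r => k i < k j)
  rw [map_sum] at h
  simp only [pim_bfree] at h
  rw [B', h, ← map_smul]
  congr 2
  funext k
  simp [ltFun]

end Generators

end MAK

/-- Theorem 3.12: the Yokonuma-Hecke-like presentation of `H_{n,r}`. -/
theorem statement10
    (R : Type*) [CommRing R] [IsDomain R] (n r : ℕ) (hn : 1 ≤ n) (hr : 1 ≤ r)
    (q Δ : Rˣ) (u : Fin r → R) (F : Fin r → R[X])
    (hΔ : (Δ : R) = ∏ i : Fin r, ∏ j ∈ Finset.univ.filter (fun j => j < i), (u i - u j))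
    (hFdeg : ∀ c : Fin r, (F c).degree = ((r - 1 : ℕ) : WithBot ℕ))
    (hFeval : ∀ c c' : Fin r, (F c).eval (u c') = if c' = c then (Δ : R) else 0) :
    ∃ φ : Hnr' R n r q u →ₐ[R] Hnr R n r q Δ u F,
      (∀ i : Fin n, φ (tt' R n r q u i) = tt R n r q Δ u F i) ∧
      (∀ j : Fin (n - 1), φ (gg' R n r q u j) = g R n r q Δ u F j) ∧
      Function.Bijective φ := by
  have hu := isUnit_sub_of_eq_prod hΔ
  set c : R := (q : R) - ((q⁻¹ : Rˣ) : R) with hc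
  have hrel : ∀ ⦃x y⦄, Rel R n r q Δ u F x y → pim R n r q Δ u F x = pim R n r q Δ u F y :=
    fun _ _ h => RingQuot.mkAlgHom_rel R h
  let π := RingQuot.mkAlgHom R (Rel' R n r q u)
  have hrel' : ∀ ⦃x y⦄, Rel' R n r q u x y → π x = π y :=
    fun _ _ h => RingQuot.mkAlgHom_rel R h
  obtain ⟨ρ, hρ⟩ := exists_algHom hu (tt R n r q Δ u F)
    (fun i j => (map_mul _ _ _).symm.trans ((hrel (.tcomm i j)).trans (map_mul _ _ _)))
    (fun i => by
      have h := hrel (.tord i)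
      rwa [← aeval_algHom_apply, map_zero] at h)
  obtain ⟨ρ', hρ'⟩ := exists_algHom hu (tt' R n r q u)
    (fun i j => (map_mul _ _ _).symm.trans ((hrel' (.tcomm i j)).trans (map_mul _ _ _)))
    (fun i => by
      have h := hrel' (.tord i)
      rwa [← aeval_algHom_apply, map_zero] at h)
  have hg : ∀ j, TT R n r q Δ u F j = g R n r q Δ u F j + ρ (ltFun r c (lo n j) (hi n j)) := by
    intro j
    rw [g, B'_eq hu hρ, neg_add_cancel_right]
  let f' : FA R n →ₐ[R] Hnr R n r q Δ u F :=
    FreeAlgebra.lift R (Sum.elim (tt R n r q Δ u F) (g R n r q Δ u F))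
  have hf't : ∀ i, f' (tf R n i) = tt R n r q Δ u F i := fun i => by simp [f', tf]
  have hf'T : ∀ j, f' (Tf R n j) = g R n r q Δ u F j := fun j => by simp [f', Tf]
  let f : FA R n →ₐ[R] Hnr' R n r q u :=
    FreeAlgebra.lift R (Sum.elim (tt' R n r q u)
      (fun j => gg' R n r q u j + ρ' (ltFun r c (lo n j) (hi n j))))
  have hft : ∀ i, f (tf R n i) = tt' R n r q u i := fun i => by simp [f, tf]
  have hfT : ∀ j, f (Tf R n j) = gg' R n r q u j + ρ' (ltFun r c (lo n j) (hi n j)) :=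
    fun j => by simp [f, Tf]
  let φ : Hnr' R n r q u →ₐ[R] Hnr R n r q Δ u F := RingQuot.liftAlgHom R
    ⟨f', rel'_of_rel (f := pim R n r q Δ u F) hu hFeval (fun i => (hρ i).symm)
      (fun i => (hf't i).trans (hρ i).symm) (fun j => by rw [hf'T]; exact hg j) hrel⟩
  let ψ : Hnr R n r q Δ u F →ₐ[R] Hnr' R n r q u := RingQuot.liftAlgHom R
    ⟨f, rel_of_rel' (f' := π) hu hFeval (fun i => (hft i).trans (hρ' i).symm)
      (fun i => (hρ' i).symm) hfT hrel'⟩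
  have hφ : ∀ x, φ (π x) = f' x := fun x => RingQuot.liftAlgHom_mkAlgHom_apply R f' _ x
  have hψ : ∀ x, ψ (pim R n r q Δ u F x) = f x := fun x =>
    RingQuot.liftAlgHom_mkAlgHom_apply R f _ x
  have hφt : ∀ i, φ (tt' R n r q u i) = tt R n r q Δ u F i := fun i => (hφ _).trans (hf't i)
  have hφg : ∀ j, φ (gg' R n r q u j) = g R n r q Δ u F j := fun j => (hφ _).trans (hf'T j)
  have hψt : ∀ i, ψ (tt R n r q Δ u F i) = tt' R n r q u i := fun i => (hψ _).trans (hft i)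
  have hψT : ∀ j, ψ (TT R n r q Δ u F j) =
      gg' R n r q u j + ρ' (ltFun r c (lo n j) (hi n j)) := fun j => (hψ _).trans (hfT j)
  have hφρ : φ.comp ρ' = ρ := algHom_ext hu fun i => by
    rw [AlgHom.comp_apply, hρ', hφt, hρ]
  have hψρ : ψ.comp ρ = ρ' := algHom_ext hu fun i => by
    rw [AlgHom.comp_apply, hρ, hψt, hρ']
  have hψg : ∀ j, ψ (g R n r q Δ u F j) = gg' R n r q u j := by
    intro j
    rw [eq_sub_of_add_eq (hg j).symm, map_sub, hψT, ← AlgHom.comp_apply, hψρ, add_sub_cancel_right]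
  have hφψ : φ.comp ψ = AlgHom.id R _ := by
    refine RingQuot.ringQuot_ext' R _ _ (FreeAlgebra.hom_ext (funext ?_))
    rintro (i | j)
    · exact (congrArg φ (hψt i)).trans (hφt i)
    · refine (congrArg φ (hψT j)).trans ?_
      rw [map_add, hφg, ← AlgHom.comp_apply, hφρ]
      exact (hg j).symm
  have hψφ : ψ.comp φ = AlgHom.id R _ := by
    refine RingQuot.ringQuot_ext' R _ _ (FreeAlgebra.hom_ext (funext ?_))
    rintro (i | j)
    · exact (congrArg ψ (hφt i)).trans (hψt i)
    · exact (congrArg ψ (hφg j)).trans (hψg j)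
  exact ⟨φ, hφt, hφg, Function.bijective_iff_has_inverse.2
    ⟨ψ, DFunLike.congr_fun hψφ, DFunLike.congr_fun hφψ⟩⟩
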